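/- Let d ≥ 2, let P be a d-polytope, and let 0 ≤ k ≤ d−2. Then the sum, over all facets F of P, of the solid angle sums φ_k(F) (each facet F regarded as a (d−1)-polytope in its own affine hull) satisfies Σ_{F facet of P} φ_k(F) ≥ ρ(d, d−k−1) · f_{d−1}(P). -/

import Mathlib

noncomputable section

/-- Euclidean space `ℝ^n`. -/
abbrev Euc (n : ℕ) : Type := EuclideanSpace ℝ (Fin n)

/-- A polytope is the convex hull of finitely many points. -/
def IsPolytope {E : Type*} [NormedAddCommGroup E] [InnerProductSpace ℝ E] (P : Set E) : Prop :=
  ∃ V : Finset E, P = convexHull ℝ (V : Set E)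

/-- `G` is a face of `P`: `P` itself, the empty set, or the intersection of `P` with a
supporting hyperplane. -/
def IsFace {E : Type*} [NormedAddCommGroup E] [InnerProductSpace ℝ E] (P G : Set E) : Prop :=
  G = P ∨ G = ∅ ∨ ∃ f : E →L[ℝ] ℝ, f ≠ 0 ∧ ∃ c : ℝ,
    (∀ x ∈ P, f x ≤ c) ∧ G = {x ∈ P | f x = c}

/-- The (affine) dimension of a nonempty set. -/
noncomputable def dimSet {E : Type*} [NormedAddCommGroup E] [InnerProductSpace ℝ E]
    (s : Set E) : ℕ :=
  Module.finrank ℝ (affineSpan ℝ s).direction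

/-- `G` is a `k`-dimensional face of `P`. -/
def IsKFace {E : Type*} [NormedAddCommGroup E] [InnerProductSpace ℝ E]
    (P : Set E) (k : ℕ) (G : Set E) : Prop :=
  IsFace P G ∧ G.Nonempty ∧ dimSet G = k

/-- `fVec P k` is the number of `k`-dimensional faces of `P`. -/
noncomputable def fVec {E : Type*} [NormedAddCommGroup E] [InnerProductSpace ℝ E]
    (P : Set E) (k : ℕ) : ℕ :=
  {G | IsKFace P k G}.ncard

/-- `ρ(d,k) = (1/2)(binom(⌈d/2⌉,k) + binom(⌊d/2⌋,k))`. -/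
def rho (d k : ℕ) : ℚ :=
  (((d + 1) / 2).choose k + (d / 2).choose k) / 2

open MeasureTheory in
/-- `a` is the solid angle of the (full-dimensional) polytope `Q` at its face `G`:
for any point `z` in the relative interior of `G` and any sufficiently small ball `B`
around `z`, `a = λ(B ∩ Q)/λ(B)`. -/
def IsSolidAngle {n : ℕ} (Q G : Set (Euc n)) (a : ℝ) : Prop :=
  ∀ z ∈ intrinsicInterior ℝ G, ∀ᶠ r in nhdsWithin (0 : ℝ) (Set.Ioi 0),
    (volume (Metric.ball z r ∩ Q)).toReal / (volume (Metric.ball z r)).toReal = a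

/-- `s = φ_k(Q)`, the sum of the solid angles of `Q` at its `k`-dimensional faces. -/
def IsSolidAngleSum {n : ℕ} (Q : Set (Euc n)) (k : ℕ) (s : ℝ) : Prop :=
  ∃ (faces : Finset (Set (Euc n))) (a : Set (Euc n) → ℝ),
    (faces : Set (Set (Euc n))) = {G | IsKFace Q k G} ∧
    (∀ G ∈ faces, IsSolidAngle Q G (a G)) ∧
    s = ∑ G ∈ faces, a G

/-- `s = φ_k(F)` for a `(d-1)`-dimensional polytope `F ⊆ ℝ^d`, computed intrinsically in
the affine hull of `F`: there is an affine isometry `e : ℝ^{d-1} → ℝ^d` with range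
`aff(F)`, and `s` is the `k`-th solid angle sum of the full-dimensional copy
`e⁻¹(F) ⊆ ℝ^{d-1}` of `F`. (Solid angles are isometry invariants, so the choice of `e`
does not matter.) -/
def IsIntrinsicSolidAngleSum {d : ℕ} (F : Set (Euc d)) (k : ℕ) (s : ℝ) : Prop :=
  ∃ e : Euc (d - 1) →ᵃⁱ[ℝ] Euc d,
    Set.range ⇑e = (affineSpan ℝ F : Set (Euc d)) ∧
    IsSolidAngleSum (⇑e ⁻¹' F) k s

/-- `Z` consists of the vectors of the finite configuration `W` lying on a common supporting
hyperplane through the origin, i.e. it is the trace of a face of the cone spanned by `W`. -/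
def IsConeFace {D : Type*} [AddCommGroup D] [Module ℝ D] (W Z : Finset D) : Prop :=
  ∃ f : Module.Dual ℝ D, (∀ w ∈ W, 0 ≤ f w) ∧ ∀ w, w ∈ Z ↔ w ∈ W ∧ f w = 0

namespace IsConeFace

variable {D : Type*} [AddCommGroup D] [Module ℝ D] {W X Y Z : Finset D}

lemma subset (hZ : IsConeFace W Z) : Z ⊆ W := by
  obtain ⟨f, -, hf⟩ := hZ
  exact fun w hw => ((hf w).1 hw).1

lemma self (W : Finset D) : IsConeFace W W := ⟨0, by simp, by simp⟩

lemma eq_zero_of_mem_span {f : Module.Dual ℝ D} {s : Set D} (hf : ∀ w ∈ s, f w = 0) {w : D}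
    (hw : w ∈ Submodule.span ℝ s) : f w = 0 := by
  have : Submodule.span ℝ s ≤ LinearMap.ker f := Submodule.span_le.2 fun w hw => hf w hw
  exact this hw

lemma mem_of_mem_span (hZ : IsConeFace W Z) {w : D} (hw : w ∈ W)
    (hs : w ∈ Submodule.span ℝ (Z : Set D)) : w ∈ Z := by
  obtain ⟨f, -, hf⟩ := hZ
  exact (hf w).2 ⟨hw, eq_zero_of_mem_span (fun v hv => ((hf v).1 hv).2) hs⟩

lemma finrank_mono {s t : Set D} [FiniteDimensional ℝ D] (h : s ⊆ t) :
    Set.finrank ℝ s ≤ Set.finrank ℝ t :=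
  Submodule.finrank_mono (Submodule.span_mono h)

lemma finrank_lt (hX : IsConeFace W X) (hXZ : X ⊂ Z) (hZ : Z ⊆ W) :
    Set.finrank ℝ (X : Set D) < Set.finrank ℝ (Z : Set D) := by
  obtain ⟨w, hwZ, hwX⟩ := Finset.exists_of_ssubset hXZ
  refine Submodule.finrank_lt_finrank_of_lt
    (lt_of_le_of_ne (Submodule.span_mono (by exact_mod_cast hXZ.1)) fun h => ?_)
  exact hwX (hX.mem_of_mem_span (hZ hwZ) (h ▸ Submodule.subset_span hwZ))

/-- A face of a face is a face. -/
lemma of_face (hZ : IsConeFace W Z) {g : Module.Dual ℝ D} (hg : ∀ w ∈ Z, 0 ≤ g w)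
    (hY : ∀ w, w ∈ Y ↔ w ∈ Z ∧ g w = 0) : IsConeFace W Y := by
  obtain ⟨f, hf0, hf⟩ := hZ
  set c : ℝ := ∑ w ∈ W, |g w| / f w + 1 with hc
  have hpos : ∀ w ∈ W, f w ≠ 0 → 0 < g w + c * f w := by
    intro w hw hne
    have hfw : 0 < f w := lt_of_le_of_ne (hf0 w hw) hne.symm
    have h1 : |g w| / f w ≤ ∑ w ∈ W, |g w| / f w :=
      Finset.single_le_sum (f := fun w => |g w| / f w)
        (fun v hv => div_nonneg (abs_nonneg _) (hf0 v hv)) hw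
    have h2 : |g w| = |g w| / f w * f w := by field_simp
    have h3 : |g w| + f w ≤ c * f w := by
      rw [hc, add_mul, one_mul]
      nlinarith
    linarith [neg_abs_le (g w)]
  refine ⟨g + c • f, fun w hw => ?_, fun w => ?_⟩
  · by_cases h : f w = 0
    · simpa [h] using hg w ((hf w).2 ⟨hw, h⟩)
    · simpa using (hpos w hw h).le
  · rw [hY, hf]
    constructor
    · rintro ⟨⟨h1, h2⟩, h3⟩
      exact ⟨h1, by simp [h2, h3]⟩
    · rintro ⟨h1, h2⟩
      by_cases h : f w = 0
      · exact ⟨⟨h1, h⟩, by simpa [h] using h2⟩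
      · exact absurd h2 (by simpa using (hpos w h1 h).ne')

/-- Maximizing the ratio of a functional `g` vanishing on `X` to a functional `x` cutting out `X`
over a larger face `Z` yields a face strictly between. -/
lemma exists_ratio_face (hZ : IsConeFace W Z) (hXZ : X ⊂ Z) {x g : Module.Dual ℝ D}
    (hx0 : ∀ w ∈ W, 0 ≤ x w) (hx : ∀ w, w ∈ X ↔ w ∈ W ∧ x w = 0) (hg : ∀ w ∈ X, g w = 0) :
    ∃ (m : ℝ) (Y : Finset D), IsConeFace W Y ∧ X ⊂ Y ∧ Y ⊆ Z ∧ (∀ w ∈ Z, g w ≤ m * x w) ∧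
      ∀ w ∈ Y, g w = m * x w := by
  classical
  obtain ⟨w₁, hw₁Z, hw₁X⟩ := Finset.exists_of_ssubset hXZ
  obtain ⟨w₀, hw₀, hmax⟩ := Finset.exists_max_image (Z \ X) (fun w => g w / x w)
    ⟨w₁, Finset.mem_sdiff.2 ⟨hw₁Z, hw₁X⟩⟩
  rw [Finset.mem_sdiff] at hw₀
  have hxpos : ∀ w ∈ Z, w ∉ X → 0 < x w := fun w hw hwX =>
    lt_of_le_of_ne (hx0 w (hZ.subset hw)) fun h => hwX ((hx w).2 ⟨hZ.subset hw, h.symm⟩)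
  set m := g w₀ / x w₀ with hm
  have hle : ∀ w ∈ Z, g w ≤ m * x w := by
    intro w hw
    by_cases hwX : w ∈ X
    · rw [hg w hwX, ((hx w).1 hwX).2, mul_zero]
    · exact (div_le_iff₀ (hxpos w hw hwX)).1 (hmax w (Finset.mem_sdiff.2 ⟨hw, hwX⟩))
  have hmem : ∀ w, w ∈ {w ∈ Z | (m • x - g) w = 0} ↔ w ∈ Z ∧ (m • x - g) w = 0 := by simp
  refine ⟨m, {w ∈ Z | (m • x - g) w = 0}, hZ.of_face (fun w hw => ?_) hmem, ?_,
    Finset.filter_subset _ _, hle, fun w hw => ?_⟩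
  · simpa using hle w hw
  · refine Finset.ssubset_iff_subset_ne.2 ⟨fun w hw => ?_, fun h => hw₀.2 ?_⟩
    · rw [hmem]
      exact ⟨hXZ.1 hw, by simp [hg w hw, ((hx w).1 hw).2]⟩
    · rw [h, hmem]
      refine ⟨hw₀.1, ?_⟩
      have := hxpos w₀ hw₀.1 hw₀.2
      simp only [LinearMap.sub_apply, LinearMap.smul_apply, smul_eq_mul, hm]
      field_simp
      ring
  · have := ((hmem w).1 hw).2
    simp only [LinearMap.sub_apply, LinearMap.smul_apply, smul_eq_mul] at this
    linarith

lemma finrank_insert_le [DecidableEq D] (X : Finset D) (w : D) :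
    Set.finrank ℝ ((insert w X : Finset D) : Set D) ≤ Set.finrank ℝ (X : Set D) + 1 := by
  unfold Set.finrank
  rw [Finset.coe_insert, Submodule.span_insert]
  refine (Submodule.finrank_add_le_finrank_add_finrank _ _).trans ?_
  rw [add_comm]
  gcongr
  simpa using finrank_span_le_card (R := ℝ) ({w} : Set D)

lemma exists_between (hX : IsConeFace W X) (hZ : IsConeFace W Z) (hXZ : X ⊆ Z) {w₁ : D}
    (hw₁Z : w₁ ∈ Z) (hw₁X : w₁ ∉ X)
    (hr : Set.finrank ℝ (X : Set D) + 2 ≤ Set.finrank ℝ (Z : Set D)) :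
    ∃ Y, IsConeFace W Y ∧ X ⊂ Y ∧ Y ⊆ Z ∧ w₁ ∉ Y := by
  classical
  obtain ⟨x, hx0, hx⟩ := hX
  have hss : X ⊂ Z := Finset.ssubset_iff_subset_ne.2 ⟨hXZ, fun h => hw₁X (h ▸ hw₁Z)⟩
  obtain ⟨w₂, hw₂Z, hw₂⟩ : ∃ w₂ ∈ Z,
      w₂ ∉ Submodule.span ℝ ((insert w₁ X : Finset D) : Set D) := by
    by_contra! h
    have h1 : Set.finrank ℝ (Z : Set D) ≤ Set.finrank ℝ ((insert w₁ X : Finset D) : Set D) :=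
      Submodule.finrank_mono (Submodule.span_le.2 h)
    have := finrank_insert_le X w₁
    omega
  obtain ⟨g, hg2, hg⟩ : ∃ g : Module.Dual ℝ D, 0 < g w₂ ∧ ∀ w ∈ insert w₁ X, g w = 0 := by
    obtain ⟨g, hg, hg'⟩ := Submodule.exists_le_ker_of_notMem hw₂
    have h0 : ∀ w ∈ insert w₁ X, g w = 0 := fun w hw => hg' (Submodule.subset_span hw)
    rcases lt_or_gt_of_ne hg with h | h
    · exact ⟨-g, by simpa using h, fun w hw => by simp [h0 w hw]⟩
    · exact ⟨g, h, h0⟩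
  obtain ⟨m, Y, hY, hXY, hYZ, hle, heq⟩ := exists_ratio_face hZ hss hx0 hx (g := g)
    (fun w hw => hg w (Finset.mem_insert_of_mem hw))
  refine ⟨Y, hY, hXY, hYZ, fun hw => ?_⟩
  have h1 := heq _ hw
  rw [hg _ (Finset.mem_insert_self _ _)] at h1
  have hx1 : x w₁ ≠ 0 := fun h => hw₁X ((hx _).2 ⟨hZ.subset hw₁Z, h⟩)
  have hm : m = 0 := by
    rcases mul_eq_zero.1 h1.symm with h | h
    · exact h
    · exact absurd h hx1
  have := hle w₂ hw₂Z
  rw [hm] at this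
  linarith

lemma exists_atom (hX : IsConeFace W X) (hZ : IsConeFace W Z) (hXZ : X ⊂ Z) :
    ∃ U, IsConeFace W U ∧ X ⊂ U ∧ U ⊆ Z ∧
      Set.finrank ℝ (U : Set D) = Set.finrank ℝ (X : Set D) + 1 := by
  induction hn : Set.finrank ℝ (Z : Set D) using Nat.strong_induction_on generalizing Z with
  | _ n ih =>
    have hlt := hX.finrank_lt hXZ hZ.subset
    by_cases h : Set.finrank ℝ (X : Set D) + 2 ≤ Set.finrank ℝ (Z : Set D)
    · obtain ⟨w, hwZ, hwX⟩ := Finset.exists_of_ssubset hXZ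
      obtain ⟨Y, hY, hXY, hYZ, hwY⟩ := hX.exists_between hZ hXZ.1 hwZ hwX h
      have hYZ' : Y ⊂ Z := Finset.ssubset_iff_subset_ne.2 ⟨hYZ, fun h => hwY (h ▸ hwZ)⟩
      obtain ⟨U, hU, h1, h2, h3⟩ := ih _ (hn ▸ hY.finrank_lt hYZ' hZ.subset) hY hXY rfl
      exact ⟨U, hU, h1, h2.trans hYZ, h3⟩
    · exact ⟨Z, hZ, hXZ, subset_rfl, by omega⟩

lemma exists_coatom (hX : IsConeFace W X) (hZ : IsConeFace W Z) (hXZ : X ⊆ Z) {w : D}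
    (hwZ : w ∈ Z) (hwX : w ∉ X) :
    ∃ C, IsConeFace W C ∧ X ⊆ C ∧ C ⊆ Z ∧ w ∉ C ∧
      Set.finrank ℝ (C : Set D) + 1 = Set.finrank ℝ (Z : Set D) := by
  induction hn : Set.finrank ℝ (Z : Set D) - Set.finrank ℝ (X : Set D)
    using Nat.strong_induction_on generalizing X with
  | _ n ih =>
    have hss : X ⊂ Z := Finset.ssubset_iff_subset_ne.2 ⟨hXZ, fun h => hwX (h ▸ hwZ)⟩
    have hlt := hX.finrank_lt hss hZ.subset
    by_cases h : Set.finrank ℝ (X : Set D) + 2 ≤ Set.finrank ℝ (Z : Set D)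
    · obtain ⟨Y, hY, hXY, hYZ, hwY⟩ := hX.exists_between hZ hXZ hwZ hwX h
      have h1 := hX.finrank_lt hXY hY.subset
      obtain ⟨C, hC, h1, h2, h3⟩ := ih _ (by omega) hY hYZ hwY rfl
      exact ⟨C, hC, hXY.1.trans h1, h2, h3⟩
    · exact ⟨X, hX, subset_rfl, hXZ, hwX, by omega⟩

/-- Over a face `X`, an atom `U` is spanned by `X` and any one further vector. -/
lemma mem_span_of_atom [DecidableEq D] {U : Finset D} (hX : IsConeFace W X)
    (hU : IsConeFace W U) (hXU : X ⊂ U)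
    (hr : Set.finrank ℝ (U : Set D) = Set.finrank ℝ (X : Set D) + 1) {w v : D} (hw : w ∈ U)
    (hwX : w ∉ X) (hv : v ∈ U) :
    v ∈ Submodule.span ℝ ((insert w X : Finset D) : Set D) := by
  have hle : Submodule.span ℝ ((insert w X : Finset D) : Set D) ≤
      Submodule.span ℝ (U : Set D) :=
    Submodule.span_mono (by
      exact_mod_cast Finset.insert_subset hw hXU.1)
  have hlt := hX.finrank_lt (Finset.ssubset_insert hwX)
    (Finset.insert_subset (hU.subset hw) hX.subset)
  have : Submodule.span ℝ ((insert w X : Finset D) : Set D) = Submodule.span ℝ (U : Set D) :=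
    Submodule.eq_of_le_of_finrank_le hle (by
      change Set.finrank ℝ (U : Set D) ≤ Set.finrank ℝ ((insert w X : Finset D) : Set D)
      omega)
  rw [this]
  exact Submodule.subset_span hv

/-- For a functional `h` vanishing on a face `X`, there are faces `A` and `B` over `X` on the two
sides of `h` whose ranks over `X` add up to at least the rank of the configuration over `X`. -/
theorem exists_opposite_faces [FiniteDimensional ℝ D] (hX : IsConeFace W X) (h : Module.Dual ℝ D)
    (hh : ∀ w ∈ X, h w = 0) :
    ∃ A B, IsConeFace W A ∧ IsConeFace W B ∧ X ⊆ A ∧ X ⊆ B ∧ (∀ w ∈ A, 0 ≤ h w) ∧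
      (∀ w ∈ B, w ∉ X → h w < 0) ∧
      Set.finrank ℝ (W : Set D) + Set.finrank ℝ (X : Set D) ≤
        Set.finrank ℝ (A : Set D) + Set.finrank ℝ (B : Set D) := by
  classical
  induction hn : Set.finrank ℝ (W : Set D) - Set.finrank ℝ (X : Set D)
    using Nat.strong_induction_on generalizing X h with
  | _ n ih =>
    obtain ⟨x, hx0, hx⟩ := id hX
    have hxpos : ∀ w ∈ W, w ∉ X → 0 < x w := fun w hw hwX =>
      lt_of_le_of_ne (hx0 w hw) fun h => hwX ((hx w).2 ⟨hw, h.symm⟩)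
    set S : Finset D := {w ∈ W \ X | 0 ≤ h w ∧ ∃ U, IsConeFace W U ∧ X ⊂ U ∧
      Set.finrank ℝ (U : Set D) = Set.finrank ℝ (X : Set D) + 1 ∧ w ∈ U} with hS
    -- on a face over `X` on which `h` is somewhere nonnegative, `S` attains the maximal ratio
    have key : ∀ Z, IsConeFace W Z → X ⊆ Z → ∀ w ∈ Z, w ∉ X → 0 ≤ h w →
        ∃ v ∈ S, v ∈ Z := by
      intro Z hZ hXZ w hwZ hwX hw
      have hss : X ⊂ Z := Finset.ssubset_iff_subset_ne.2 ⟨hXZ, fun h => hwX (h ▸ hwZ)⟩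
      obtain ⟨m, Y, hY, hXY, hYZ, hle, heq⟩ := exists_ratio_face hZ hss hx0 hx hh
      obtain ⟨U, hU, hXU, hUY, hUr⟩ := hX.exists_atom hY hXY
      obtain ⟨v, hvU, hvX⟩ := Finset.exists_of_ssubset hXU
      have hm : 0 ≤ m := by
        by_contra! hm
        have h1 := hxpos w (hZ.subset hwZ) hwX
        have := hle w hwZ
        nlinarith
      refine ⟨v, ?_, hYZ (hUY hvU)⟩
      simp only [hS, Finset.mem_filter, Finset.mem_sdiff]
      refine ⟨⟨hU.subset hvU, hvX⟩, ?_, U, hU, hXU, hUr, hvU⟩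
      rw [heq v (hUY hvU)]
      exact mul_nonneg hm (hx0 v (hU.subset hvU))
    rcases S.eq_empty_or_nonempty with hSe | hSne
    · refine ⟨X, W, hX, self W, subset_rfl, hX.subset, fun w hw => (hh w hw).ge,
        fun w hw hwX => ?_, by omega⟩
      by_contra! hw0
      obtain ⟨v, hv, -⟩ := key W (self W) hX.subset w hw hwX hw0
      simp [hSe] at hv
    · obtain ⟨w₀, hw₀S, hmin⟩ := Finset.exists_min_image S (fun w => h w / x w) hSne
      have hw₀ := hw₀S
      simp only [hS, Finset.mem_filter, Finset.mem_sdiff] at hw₀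
      obtain ⟨⟨hw₀W, hw₀X⟩, hw₀h, U, hU, hXU, hUr, hw₀U⟩ := hw₀
      set s := h w₀ / x w₀ with hs
      have hs0 : 0 ≤ s := div_nonneg hw₀h (hx0 w₀ hw₀W)
      have hx₀ := hxpos w₀ hw₀W hw₀X
      have hU0 : ∀ w ∈ U, (h - s • x) w = 0 := by
        intro w hw
        refine eq_zero_of_mem_span (fun v hv => ?_)
          (mem_span_of_atom hX hU hXU hUr hw₀U hw₀X hw)
        rcases Finset.mem_insert.1 hv with rfl | hv
        · simp only [LinearMap.sub_apply, LinearMap.smul_apply, smul_eq_mul, hs]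
          field_simp
          ring
        · simp [hh v hv, ((hx v).1 hv).2]
      have hUW := finrank_mono (D := D) (s := U) (t := W) (by exact_mod_cast hU.subset)
      obtain ⟨A, B', hA, hB', hUA, hUB', hAh, hB'h, hr⟩ :=
        ih _ (by omega) hU (h - s • x) hU0 rfl
      obtain ⟨B, hB, hXB, hBB', hwB, hBr⟩ :=
        hX.exists_coatom hB' (hXU.1.trans hUB') (hUB' hw₀U) hw₀X
      refine ⟨A, B, hA, hB, hXU.1.trans hUA, hXB, fun w hw => ?_, fun w hw hwX => ?_, by omega⟩
      · have h1 := hAh w hw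
        simp only [LinearMap.sub_apply, LinearMap.smul_apply, smul_eq_mul] at h1
        have h2 := mul_nonneg hs0 (hx0 w (hA.subset hw))
        linarith
      · by_contra! hw0
        obtain ⟨v, hvS, hvB⟩ := key B hB hXB w hw hwX hw0
        have hvX : v ∉ X := by
          have := hvS
          simp only [hS, Finset.mem_filter, Finset.mem_sdiff] at this
          exact this.1.2
        have hvU : v ∉ U := by
          intro hvU
          refine hwB (hB.mem_of_mem_span hw₀W ?_)
          exact Submodule.span_mono (by exact_mod_cast Finset.insert_subset hvB hXB)
            (mem_span_of_atom hX hU hXU hUr hvU hvX hw₀U)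
        have h1 := hB'h v (hBB' hvB) hvU
        simp only [LinearMap.sub_apply, LinearMap.smul_apply, smul_eq_mul] at h1
        have h2 := hmin v hvS
        rw [le_div_iff₀ (hxpos v (hB.subset hvB) hvX)] at h2
        linarith

open scoped Classical Finset in
/-- The face lattice of a configuration has, in an interval of length `p`, at least as many
elements of each rank as the Boolean lattice of rank `p`. -/
theorem choose_le_card (hX : IsConeFace W X) (hZ : IsConeFace W Z) (hXZ : X ⊆ Z) {p : ℕ}
    (hp : Set.finrank ℝ (Z : Set D) = Set.finrank ℝ (X : Set D) + p) (j : ℕ) :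
    p.choose j ≤ #{Y ∈ W.powerset | IsConeFace W Y ∧ X ⊆ Y ∧ Y ⊆ Z ∧
      Set.finrank ℝ (Y : Set D) = Set.finrank ℝ (X : Set D) + j} := by
  induction p generalizing X Z j with
  | zero =>
    rcases j with _ | j
    · rw [Nat.choose_zero_right, Nat.succ_le_iff, Finset.card_pos]
      exact ⟨X, by simp [hX, hXZ, hX.subset]⟩
    · simp
  | succ p ih =>
    rcases j with _ | j
    · rw [Nat.choose_zero_right, Nat.succ_le_iff, Finset.card_pos]
      exact ⟨X, by simp [hX, hXZ, hX.subset]⟩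
    have hss : X ⊂ Z := Finset.ssubset_iff_subset_ne.2 ⟨hXZ, fun h => by subst h; omega⟩
    obtain ⟨U, hU, hXU, hUZ, hUr⟩ := hX.exists_atom hZ hss
    obtain ⟨w, hwU, hwX⟩ := Finset.exists_of_ssubset hXU
    obtain ⟨C, hC, hXC, hCZ, hwC, hCr⟩ := hX.exists_coatom hZ hXZ (hUZ hwU) hwX
    have h1 := ih hU hZ hUZ (by omega) j
    have h2 := ih hX hC hXC (by omega) (j + 1)
    rw [Nat.choose_succ_succ]
    refine (add_le_add h1 h2).trans ?_
    rw [← Finset.card_union_of_disjoint]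
    · refine Finset.card_le_card fun Y hY => ?_
      simp only [Finset.mem_union, Finset.mem_filter, Finset.mem_powerset] at hY ⊢
      rcases hY with ⟨ha, hb, hc, hd, he⟩ | ⟨ha, hb, hc, hd, he⟩
      · exact ⟨ha, hb, hXU.1.trans hc, hd, by omega⟩
      · exact ⟨ha, hb, hc, hd.trans hCZ, by omega⟩
    · rw [Finset.disjoint_left]
      intro Y hY hY'
      simp only [Finset.mem_filter] at hY hY'
      exact hwC (hY'.2.2.2.1 (hY.2.2.1 hwU))

end IsConeFace

/-- A finitely generated cone is an intersection of finitely many half-spaces. -/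
theorem exists_finset_dual_of_cone {ι M : Type*} [AddCommGroup M] [Module ℝ M]
    [FiniteDimensional ℝ M] (s : Finset ι) (g : ι → M) :
    ∃ T : Finset (Module.Dual ℝ M), ∀ x : M,
      (∃ c : ι → ℝ, (∀ i ∈ s, 0 ≤ c i) ∧ ∑ i ∈ s, c i • g i = x) ↔ ∀ f ∈ T, 0 ≤ f x := by
  classical
  induction s using Finset.induction_on with
  | empty =>
    let b := Module.finBasis ℝ M
    refine ⟨Finset.univ.image b.coord ∪ Finset.univ.image (-b.coord), fun x => ?_⟩
    constructor
    · rintro ⟨c, -, rfl⟩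
      simp
    · intro h
      refine ⟨0, by simp, ?_⟩
      rw [Finset.sum_empty, eq_comm, ← b.forall_coord_eq_zero_iff]
      intro i
      have h1 := h (b.coord i) (by simp)
      have h2 := h (-b.coord i) (by
        simp only [Finset.mem_union, Finset.mem_image, Finset.mem_univ, true_and]
        exact Or.inr ⟨i, rfl⟩)
      simp only [LinearMap.neg_apply] at h2
      linarith
  | insert a s ha ih =>
    obtain ⟨T, hT⟩ := ih
    have hstep : ∀ x : M, (∃ c : ι → ℝ, (∀ i ∈ insert a s, 0 ≤ c i) ∧
        ∑ i ∈ insert a s, c i • g i = x) ↔ ∃ t : ℝ, 0 ≤ t ∧ ∀ f ∈ T, 0 ≤ f (x - t • g a) := by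
      intro x
      constructor
      · rintro ⟨c, hc, rfl⟩
        refine ⟨c a, hc a (Finset.mem_insert_self _ _), (hT _).1 ⟨c, fun i hi =>
          hc i (Finset.mem_insert_of_mem hi), ?_⟩⟩
        rw [Finset.sum_insert ha]
        abel
      · rintro ⟨t, ht, h⟩
        obtain ⟨c, hc, hcx⟩ := (hT _).2 h
        have hne : ∀ i ∈ s, i ≠ a := fun i hi h => ha (h ▸ hi)
        refine ⟨fun i => if i = a then t else c i, fun i hi => ?_, ?_⟩
        · rcases Finset.mem_insert.1 hi with rfl | hi
          · simpa using ht
          · simpa [hne i hi] using hc i hi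
        · rw [Finset.sum_insert ha, Finset.sum_congr rfl (g := fun i => c i • g i)
            (fun i hi => by simp [hne i hi]), hcx]
          simp
    -- Fourier–Motzkin elimination of the coefficient `t` of the new generator
    refine ⟨{f ∈ T | 0 ≤ f (g a)} ∪ ({p ∈ T ×ˢ T | 0 < p.1 (g a) ∧ p.2 (g a) < 0}).image
      (fun p => p.1 (g a) • p.2 - p.2 (g a) • p.1), fun x => (hstep x).trans ?_⟩
    constructor
    · rintro ⟨t, ht, h⟩ f hf
      rcases Finset.mem_union.1 hf with hf | hf
      · rw [Finset.mem_filter] at hf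
        have h1 := h f hf.1
        have h2 := mul_nonneg ht hf.2
        simp only [map_sub, map_smul, smul_eq_mul] at h1
        linarith
      · obtain ⟨p, hp, rfl⟩ := Finset.mem_image.1 hf
        rw [Finset.mem_filter, Finset.mem_product] at hp
        have h1 := h p.1 hp.1.1
        have h2 := h p.2 hp.1.2
        simp only [map_sub, map_smul, smul_eq_mul] at h1 h2
        simp only [LinearMap.sub_apply, LinearMap.smul_apply, smul_eq_mul]
        nlinarith [mul_nonneg hp.2.1.le h2, mul_nonneg (neg_nonneg.2 hp.2.2.le) h1]
    · intro h
      have hpos : ∀ f ∈ T, 0 ≤ f (g a) → 0 ≤ f x := fun f hf hfa =>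
        h f (Finset.mem_union_left _ (Finset.mem_filter.2 ⟨hf, hfa⟩))
      have hpair : ∀ f ∈ T, ∀ f' ∈ T, 0 < f (g a) → f' (g a) < 0 →
          0 ≤ f (g a) * f' x - f' (g a) * f x := fun f hf f' hf' h1 h2 => by
        have := h _ (Finset.mem_union_right _ (Finset.mem_image.2 ⟨(f, f'),
          Finset.mem_filter.2 ⟨Finset.mem_product.2 ⟨hf, hf'⟩, h1, h2⟩, rfl⟩))
        simpa using this
      -- take `t` to be the largest lower bound
      obtain ⟨t, ht, hneg, hub⟩ : ∃ t : ℝ, 0 ≤ t ∧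
          (∀ f ∈ T, f (g a) < 0 → f x / f (g a) ≤ t) ∧
          (∀ f ∈ T, 0 < f (g a) → t * f (g a) ≤ f x) := by
        by_cases hN : ∃ f ∈ T, f (g a) < 0 ∧ 0 ≤ f x / f (g a)
        · obtain ⟨f₁, hf₁, h1, h2⟩ := hN
          obtain ⟨f₀, hf₀, hmax⟩ := Finset.exists_max_image {f ∈ T | f (g a) < 0}
            (fun f => f x / f (g a)) ⟨f₁, Finset.mem_filter.2 ⟨hf₁, h1⟩⟩
          rw [Finset.mem_filter] at hf₀
          refine ⟨f₀ x / f₀ (g a), h2.trans (hmax _ (Finset.mem_filter.2 ⟨hf₁, h1⟩)),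
            fun f hf hfa => hmax _ (Finset.mem_filter.2 ⟨hf, hfa⟩), fun f hf hfa => ?_⟩
          have := hpair f hf f₀ hf₀.1 hfa hf₀.2
          rw [div_mul_eq_mul_div, div_le_iff_of_neg hf₀.2]
          linarith
        · push Not at hN
          exact ⟨0, le_rfl, fun f hf hfa => (hN f hf hfa).le, fun f hf hfa => by
            simpa using hpos f hf hfa.le⟩
      refine ⟨t, ht, fun f hf => ?_⟩
      simp only [map_sub, map_smul, smul_eq_mul]
      rcases lt_trichotomy (f (g a)) 0 with hfa | hfa | hfa
      · have := (div_le_iff_of_neg hfa).1 (hneg f hf hfa)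
        linarith
      · simpa [hfa] using hpos f hf hfa.ge
      · linarith [hub f hf hfa]

/-- A polytope is an intersection of finitely many half-spaces. -/
theorem IsPolytope.exists_halfspaces {E : Type*} [NormedAddCommGroup E] [InnerProductSpace ℝ E]
    [FiniteDimensional ℝ E] {P : Set E} (hP : IsPolytope P) :
    ∃ T : Finset (Module.Dual ℝ (E × ℝ)), ∀ x : E, x ∈ P ↔ ∀ f ∈ T, 0 ≤ f (x, 1) := by
  obtain ⟨V, rfl⟩ := hP
  obtain ⟨T, hT⟩ := exists_finset_dual_of_cone V (fun v : E => (v, (1 : ℝ)))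
  refine ⟨T, fun x => ?_⟩
  rw [← hT, Finset.mem_convexHull']
  refine exists_congr fun c => and_congr_right fun _ => ?_
  rw [Prod.ext_iff, Prod.fst_sum, Prod.snd_sum]
  simp [and_comm]

/-- Splitting `n` as evenly as possible minimizes the sum of binomial coefficients. -/
lemma choose_half_le {n p q : ℕ} (h : n ≤ p + q) (j : ℕ) :
    ((n + 1) / 2).choose j + (n / 2).choose j ≤ p.choose j + q.choose j := by
  have aux : ∀ m a b : ℕ, b ≤ a → (a + m).choose j + b.choose j ≤
      (a + m + 1).choose j + (b - 1).choose j ∨ b = 0 := by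
    intro m a b hba
    rcases b with _ | b
    · exact Or.inr rfl
    left
    rcases j with _ | j
    · simp
    · rw [Nat.choose_succ_succ (a + m) j, Nat.choose_succ_succ b j, Nat.add_sub_cancel]
      have := Nat.choose_le_choose j (show b ≤ a + m by omega)
      simp only [Nat.succ_eq_add_one]
      omega
  have main : ∀ k a b : ℕ, b ≤ a → k ≤ b →
      a.choose j + b.choose j ≤ (a + k).choose j + (b - k).choose j := by
    intro k a b hba
    induction k with
    | zero => simp
    | succ k ih =>
      intro hk
      have h1 := ih (by omega)
      rcases aux k a (b - k) (by omega) with h2 | h2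
      · rw [show b - (k + 1) = b - k - 1 by omega, ← add_assoc]
        omega
      · omega
  wlog hpq : q ≤ p generalizing p q
  · rw [add_comm (p.choose j)]
    exact this (by omega) (by omega)
  by_cases hqn : q ≤ n / 2
  · have h1 := main (n / 2 - q) ((n + 1) / 2) (n / 2) (by omega) (by omega)
    rw [show n / 2 - (n / 2 - q) = q by omega] at h1
    have := Nat.choose_le_choose j (show (n + 1) / 2 + (n / 2 - q) ≤ p by omega)
    omega
  · exact add_le_add (Nat.choose_le_choose j (by omega)) (Nat.choose_le_choose j (by omega))

/-- A segment ending at a relative interior point can be prolonged. -/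
lemma exists_prolong_mem {E : Type*} [NormedAddCommGroup E] [NormedSpace ℝ E] {s : Set E}
    {x z : E} (hz : z ∈ intrinsicInterior ℝ s) (hx : x ∈ s) :
    ∃ ε : ℝ, 0 < ε ∧ z + ε • (z - x) ∈ s := by
  obtain ⟨y, hy, rfl⟩ := mem_intrinsicInterior.1 hz
  have hmem : ∀ t : ℝ, (y : E) + t • ((y : E) - x) ∈ affineSpan ℝ s := by
    intro t
    have := AffineSubspace.vadd_mem_of_mem_direction
      ((affineSpan ℝ s).direction.smul_mem t
        (AffineSubspace.vsub_mem_direction y.2 (subset_affineSpan ℝ s hx))) y.2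
    simpa [add_comm] using this
  let γ : ℝ → affineSpan ℝ s := fun t => ⟨(y : E) + t • ((y : E) - x), hmem t⟩
  have hγ : Continuous γ := by
    refine Continuous.subtype_mk ?_ _
    fun_prop
  have h0 : γ 0 = y := by ext; simp [γ]
  have hev : ∀ᶠ t in nhds (0 : ℝ), γ t ∈ interior ((↑) ⁻¹' s : Set (affineSpan ℝ s)) :=
    hγ.continuousAt.eventually (isOpen_interior.mem_nhds (by rw [h0]; exact hy))
  obtain ⟨δ, hδ, hball⟩ := Metric.eventually_nhds_iff.1 hev
  refine ⟨δ / 2, half_pos hδ, ?_⟩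
  have := interior_subset (hball (y := δ / 2) (by
    rw [Real.dist_eq, sub_zero, abs_of_pos (half_pos hδ)]; linarith))
  exact this

/-- `Q` is the bounded full-dimensional polyhedron cut out by the finitely many affine
functionals `x ↦ f (x, 1)`, `f ∈ W`, none of which is constant. -/
structure IsHalfspaceRep {E : Type*} [NormedAddCommGroup E] [InnerProductSpace ℝ E]
    (Q : Set E) (W : Finset (Module.Dual ℝ (E × ℝ))) : Prop where
  mem_iff : ∀ x, x ∈ Q ↔ ∀ f ∈ W, 0 ≤ f (x, 1)
  exists_pos : ∃ q, ∀ f ∈ W, 0 < f (q, 1)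
  exists_ne : ∀ f ∈ W, ∃ y, f (y, 0) ≠ 0
  eq_zero : ∀ y, (∀ f ∈ W, 0 ≤ f (y, 0)) → y = 0

section HalfspaceRep

variable {E : Type*} [NormedAddCommGroup E] [InnerProductSpace ℝ E]

lemma map_mk_add_smul (f : Module.Dual ℝ (E × ℝ)) (x y : E) (t : ℝ) :
    f (x + t • y, 1) = f (x, 1) + t * f (y, 0) := by
  rw [← smul_eq_mul, ← map_smul, ← map_add]
  simp

lemma IsPolytope.exists_isHalfspaceRep [FiniteDimensional ℝ E] {Q : Set E} (hQ : IsPolytope Q)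
    (hint : (interior Q).Nonempty) : ∃ W, IsHalfspaceRep Q W := by
  classical
  obtain ⟨T, hT⟩ := hQ.exists_halfspaces
  obtain ⟨q, hq⟩ := hint
  have hqQ := interior_subset hq
  have hmem : ∀ x, x ∈ Q ↔ ∀ f ∈ ({f ∈ T | ∃ y, f (y, 0) ≠ 0} : Finset _), 0 ≤ f (x, 1) := by
    intro x
    refine (hT x).trans ⟨fun h f hf => h f (Finset.mem_filter.1 hf).1, fun h f hf => ?_⟩
    by_cases hy : ∃ y, f (y, 0) ≠ 0
    · exact h f (Finset.mem_filter.2 ⟨hf, hy⟩)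
    · push Not at hy
      have h1 := map_mk_add_smul f q (x - q) 1
      rw [hy, one_smul, add_sub_cancel] at h1
      rw [h1]
      simpa using (hT q).1 hqQ f hf
  refine ⟨_, hmem, ⟨q, fun f hf => ?_⟩, fun f hf => (Finset.mem_filter.1 hf).2, fun y hy => ?_⟩
  · obtain ⟨y, hy⟩ : ∃ y, f (y, 0) < 0 := by
      obtain ⟨y, hy⟩ := (Finset.mem_filter.1 hf).2
      rcases lt_or_gt_of_ne hy with h | h
      · exact ⟨y, h⟩
      · refine ⟨-y, ?_⟩
        have : f (-y, 0) = - f (y, 0) := by rw [← map_neg]; simp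
        linarith
    have hev : ∀ᶠ t in nhds (0 : ℝ), q + t • y ∈ Q := by
      have hc : Continuous fun t : ℝ => q + t • y := by fun_prop
      exact hc.continuousAt.eventually (by simpa using mem_interior_iff_mem_nhds.1 hq)
    obtain ⟨δ, hδ, hball⟩ := Metric.eventually_nhds_iff.1 hev
    have h1 := (hmem _).1 (hball (y := δ / 2) (by
      rw [Real.dist_eq, sub_zero, abs_of_pos (half_pos hδ)]; linarith)) f hf
    rw [map_mk_add_smul] at h1
    nlinarith
  · by_contra hne
    obtain ⟨V, rfl⟩ := hQ
    obtain ⟨R, hR⟩ := ((isBounded_convexHull).2 V.finite_toSet.isBounded).exists_norm_le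
    have hy0 : 0 < ‖y‖ := norm_pos_iff.2 hne
    have hR0 : 0 ≤ R := (norm_nonneg q).trans (hR q hqQ)
    set t : ℝ := (2 * R + 1) / ‖y‖ with ht
    have ht0 : 0 ≤ t := by positivity
    have hqt : q + t • y ∈ convexHull ℝ (V : Set E) := by
      rw [hmem]
      intro f hf
      rw [map_mk_add_smul]
      exact add_nonneg ((hmem q).1 hqQ f hf) (mul_nonneg ht0 (hy f hf))
    have h1 : ‖t • y‖ = 2 * R + 1 := by
      rw [norm_smul, Real.norm_of_nonneg ht0, ht]
      field_simp
    have h2 : ‖t • y‖ ≤ ‖q + t • y‖ + ‖q‖ := by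
      simpa using norm_sub_le (q + t • y) q
    linarith [hR _ hqt, hR _ hqQ]

namespace IsHalfspaceRep

variable {Q : Set E} {W Z : Finset (Module.Dual ℝ (E × ℝ))}

lemma snd_pos [Nontrivial E] (h : IsHalfspaceRep Q W) {m : E × ℝ} (hm : m ≠ 0)
    (hf : ∀ f ∈ W, 0 ≤ f m) : 0 < m.2 := by
  obtain ⟨y, t⟩ := m
  obtain ⟨q, hq⟩ := h.exists_pos
  obtain ⟨g, hg⟩ : W.Nonempty := by
    by_contra hW
    rw [Finset.not_nonempty_iff_eq_empty] at hW
    obtain ⟨y, hy⟩ := _root_.exists_ne (0 : E)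
    exact hy (h.eq_zero y (by simp [hW]))
  by_contra! ht
  simp only at ht
  have hy : y = t • q := by
    rw [← sub_eq_zero]
    refine h.eq_zero _ fun f hfW => ?_
    have h1 : f (y - t • q, 0) = f (y, t) - t * f (q, 1) := by
      rw [← smul_eq_mul, ← map_smul, ← map_sub]
      simp
    rw [h1]
    nlinarith [hf f hfW, hq f hfW]
  have hm' : (y, t) = t • ((q, 1) : E × ℝ) := by simp [hy]
  have ht' : t ≠ 0 := by
    rintro rfl
    exact hm (by simp [hm'])
  have h2 := hf g hg
  rw [hm', map_smul, smul_eq_mul] at h2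
  have := hq g hg
  have : t < 0 := lt_of_le_of_ne ht ht'
  nlinarith

lemma finrank_eq [FiniteDimensional ℝ E] [Nontrivial E] (h : IsHalfspaceRep Q W) :
    Set.finrank ℝ (W : Set (Module.Dual ℝ (E × ℝ))) = Module.finrank ℝ E + 1 := by
  have hbot : (Submodule.span ℝ (W : Set (Module.Dual ℝ (E × ℝ)))).dualCoannihilator = ⊥ := by
    rw [eq_bot_iff]
    intro m hm
    rw [Submodule.mem_dualCoannihilator] at hm
    have hm0 : ∀ f ∈ W, f m = 0 := fun f hf => hm f (Submodule.subset_span hf)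
    rw [Submodule.mem_bot]
    by_contra hne
    have h1 := h.snd_pos hne fun f hf => (hm0 f hf).ge
    have h2 := h.snd_pos (neg_ne_zero.2 hne) fun f hf => by simp [hm0 f hf]
    simp only [Prod.snd_neg] at h2
    linarith
  have := Subspace.finrank_add_finrank_dualCoannihilator_eq
    (Submodule.span ℝ (W : Set (Module.Dual ℝ (E × ℝ))))
  rw [hbot, finrank_bot, Module.finrank_prod, Module.finrank_self] at this
  exact this

/-- The face of `Q` on which the functionals in `Z` are tight. -/
def face (Q : Set E) (Z : Finset (Module.Dual ℝ (E × ℝ))) : Set E :=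
  {x | x ∈ Q ∧ ∀ f ∈ Z, f (x, 1) = 0}

/-- A face of the configuration of smaller rank is the set of functionals tight at some point. -/
lemma exists_point [FiniteDimensional ℝ E] [Nontrivial E]
    (h : IsHalfspaceRep Q W) (hZ : IsConeFace W Z)
    (hr : Set.finrank ℝ (Z : Set (Module.Dual ℝ (E × ℝ))) ≤ Module.finrank ℝ E) :
    ∃ x ∈ face Q Z, ∀ f ∈ W, f ∉ Z → 0 < f (x, 1) := by
  obtain ⟨φ, hφ0, hφ⟩ := id hZ
  set m := (Module.evalEquiv ℝ (E × ℝ)).symm φ with hm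
  have hφm : ∀ f, φ f = f m := by
    intro f
    rw [hm, Module.apply_evalEquiv_symm_apply]
  simp only [hφm] at hφ0 hφ
  have hm0 : m ≠ 0 := by
    intro h0
    have : Z = W := by
      ext f
      simp [hφ, h0]
    rw [this, h.finrank_eq] at hr
    omega
  have ht := h.snd_pos hm0 hφ0
  have hval : ∀ f : Module.Dual ℝ (E × ℝ), f (m.2⁻¹ • m.1, 1) = m.2⁻¹ * f m := by
    intro f
    rw [← smul_eq_mul, ← map_smul]
    congr 1
    ext
    · simp
    · simp [ht.ne']
  refine ⟨m.2⁻¹ • m.1, ⟨(h.mem_iff _).2 fun f hf => ?_, fun f hf => ?_⟩, fun f hf hfZ => ?_⟩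
  · rw [hval]
    exact mul_nonneg (inv_nonneg.2 ht.le) (hφ0 f hf)
  · rw [hval, ((hφ f).1 hf).2, mul_zero]
  · rw [hval]
    exact mul_pos (inv_pos.2 ht) (lt_of_le_of_ne (hφ0 f hf)
      fun h0 => hfZ ((hφ f).2 ⟨hf, h0.symm⟩))

lemma direction_affineSpan_face {x : E} (h : IsHalfspaceRep Q W) (hx : x ∈ face Q Z)
    (hpos : ∀ f ∈ W, f ∉ Z → 0 < f (x, 1)) :
    (affineSpan ℝ (face Q Z)).direction = ((Submodule.span ℝ (Z : Set _)).map
      (LinearMap.inl ℝ E ℝ).dualMap).dualCoannihilator := by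
  apply le_antisymm
  · rw [direction_affineSpan, vectorSpan_def, Submodule.span_le]
    rintro _ ⟨a, ha, b, hb, rfl⟩
    rw [SetLike.mem_coe, Submodule.mem_dualCoannihilator]
    rintro _ ⟨f, hf, rfl⟩
    simp only [LinearMap.dualMap_apply, LinearMap.inl_apply, vsub_eq_sub]
    have h1 : ∀ g : Module.Dual ℝ (E × ℝ), g (a - b, 0) = g (a, 1) - g (b, 1) := by
      intro g
      rw [← map_sub]
      simp
    have h2 := IsConeFace.eq_zero_of_mem_span (s := (Z : Set (Module.Dual ℝ (E × ℝ))))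
      (f := Module.Dual.eval ℝ (E × ℝ) (a - b, 0)) (fun g hg => by
        rw [Module.Dual.eval_apply, h1, ha.2 g hg, hb.2 g hg, sub_zero]) hf
    exact h2
  · intro y hy
    rw [Submodule.mem_dualCoannihilator] at hy
    have hy0 : ∀ f ∈ Z, f (y, 0) = 0 := fun f hf =>
      hy _ (Submodule.mem_map_of_mem (Submodule.subset_span hf))
    have hev : ∀ᶠ t in nhdsWithin (0 : ℝ) (Set.Ioi 0), ∀ f ∈ W, 0 ≤ f (x + t • y, 1) := by
      rw [Filter.eventually_all_finset]
      intro f hf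
      by_cases hfZ : f ∈ Z
      · refine Filter.Eventually.of_forall fun t => ?_
        rw [map_mk_add_smul, hx.2 f hfZ, hy0 f hfZ]
        simp
      · have hc : Continuous fun t : ℝ => f (x + t • y, 1) := by
          simp only [map_mk_add_smul]
          fun_prop
        refine nhdsWithin_le_nhds ((hc.continuousAt.eventually_const_lt ?_).mono
          fun t ht => le_of_lt ht)
        simpa using hpos f hf hfZ
    obtain ⟨t, ht, ht0⟩ := (hev.and self_mem_nhdsWithin).exists
    have hmem : x + t • y ∈ face Q Z := ⟨(h.mem_iff _).2 ht, fun f hf => by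
      rw [map_mk_add_smul, hx.2 f hf, hy0 f hf]
      simp⟩
    have h1 := AffineSubspace.vsub_mem_direction (subset_affineSpan ℝ _ hmem)
      (subset_affineSpan ℝ _ hx)
    rw [vsub_eq_sub, add_sub_cancel_left] at h1
    exact (Submodule.smul_mem_iff _ (ne_of_gt ht0)).1 h1

lemma finrank_map_dualMap {x : E} (hx : ∀ f ∈ Z, f (x, 1) = 0) :
    Module.finrank ℝ ((Submodule.span ℝ (Z : Set (Module.Dual ℝ (E × ℝ)))).map
      (LinearMap.inl ℝ E ℝ).dualMap) = Set.finrank ℝ (Z : Set (Module.Dual ℝ (E × ℝ))) := by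
  rw [← LinearMap.range_domRestrict]
  refine LinearMap.finrank_range_of_inj ?_
  rw [injective_iff_map_eq_zero]
  rintro ⟨f, hf⟩ h0
  rw [Submodule.mk_eq_zero]
  have hfx : f (x, 1) = 0 :=
    IsConeFace.eq_zero_of_mem_span (f := Module.Dual.eval ℝ (E × ℝ) (x, 1)) hx hf
  have hf0 : ∀ y, f (y, 0) = 0 := fun y => LinearMap.congr_fun h0 y
  ext y
  · exact hf0 y
  · have h1 := map_mk_add_smul f x (-x) 1
    rw [hf0, hfx] at h1
    simpa using h1

/-- A face of rank `j` of the configuration on which some direction is positive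
yields a face of `Q` of codimension `j`. -/
lemma isKFace_face [FiniteDimensional ℝ E] [Nontrivial E]
    (h : IsHalfspaceRep Q W) (hZ : IsConeFace W Z) {v : E}
    (hv : ∀ f ∈ Z, 0 < f (v, 0)) {k : ℕ}
    (hk : k < Module.finrank ℝ E)
    (hr : Set.finrank ℝ (Z : Set (Module.Dual ℝ (E × ℝ))) + k = Module.finrank ℝ E) :
    IsKFace Q k (face Q Z) := by
  obtain ⟨x, hx, hpos⟩ := h.exists_point hZ (by omega)
  refine ⟨Or.inr (Or.inr ?_), ⟨x, hx⟩, ?_⟩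
  · have hZne : Z.Nonempty := by
      by_contra hZe
      rw [Finset.not_nonempty_iff_eq_empty] at hZe
      subst hZe
      rw [Finset.coe_empty, Set.finrank_empty] at hr
      omega
    let g : Module.Dual ℝ (E × ℝ) := ∑ f ∈ Z, f
    have hg : ∀ m, g m = ∑ f ∈ Z, f m := fun m => by simp [g]
    have hsplit : ∀ y : E, g (y, 1) = g (y, 0) + g (0, 1) := fun y => by
      rw [← map_add]
      simp
    refine ⟨-LinearMap.toContinuousLinearMap (g ∘ₗ LinearMap.inl ℝ E ℝ), fun h0 => ?_, g (0, 1),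
      fun y hy => ?_, ?_⟩
    · have h1 := congrArg (fun l : E →L[ℝ] ℝ => l v) h0
      simp only [neg_apply, LinearMap.coe_toContinuousLinearMap',
        LinearMap.comp_apply, LinearMap.inl_apply, zero_apply, hg] at h1
      have := Finset.sum_pos hv hZne
      linarith
    · have h1 : 0 ≤ g (y, 1) := by
        rw [hg]
        exact Finset.sum_nonneg fun f hf => (h.mem_iff y).1 hy f (hZ.subset hf)
      have := hsplit y
      simp only [neg_apply, LinearMap.coe_toContinuousLinearMap',
        LinearMap.comp_apply, LinearMap.inl_apply]
      linarith
    · ext y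
      refine and_congr_right fun hy => ?_
      have h1 : g (y, 1) = 0 ↔ ∀ f ∈ Z, f (y, 1) = 0 := by
        rw [hg]
        exact Finset.sum_eq_zero_iff_of_nonneg fun f hf => (h.mem_iff y).1 hy f (hZ.subset hf)
      rw [← h1, hsplit]
      simp only [neg_apply, LinearMap.coe_toContinuousLinearMap',
        LinearMap.comp_apply, LinearMap.inl_apply]
      constructor <;> intro h2 <;> linarith
  · rw [dimSet, h.direction_affineSpan_face hx hpos]
    have h1 := Subspace.finrank_add_finrank_dualCoannihilator_eq
      ((Submodule.span ℝ (Z : Set (Module.Dual ℝ (E × ℝ)))).map (LinearMap.inl ℝ E ℝ).dualMap)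
    rw [finrank_map_dualMap hx.2] at h1
    omega

end IsHalfspaceRep

end HalfspaceRep

namespace IsHalfspaceRep

section Counting

variable {E : Type*} [NormedAddCommGroup E] [InnerProductSpace ℝ E] [FiniteDimensional ℝ E]
  [Nontrivial E] {Q : Set E} {W A : Finset (Module.Dual ℝ (E × ℝ))}

open scoped Classical Finset in
/-- If `A` lies on the positive side of a small generic vector `v`, then `v` points into `Q` from
at least as many `k`-faces as there are sets of size `dim Q - k` in a set of size `rank A`. -/
lemma choose_le_card_faces (h : IsHalfspaceRep Q W) {k j : ℕ} {K : Finset (Set E)}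
    (hK : ∀ G, G ∈ K ↔ IsKFace Q k G) {z : Set E → E}
    (hz : ∀ G ∈ K, z G ∈ intrinsicInterior ℝ G) {v : E} (hv : ∀ f ∈ W, f (v, 0) ≠ 0)
    (hsmall : ∀ G ∈ K, ∀ f ∈ W, 0 < f (z G, 1) → 0 ≤ f (z G + v, 1))
    (hA : IsConeFace W A) (hA0 : ∀ f ∈ A, 0 ≤ f (v, 0)) (hk : k < Module.finrank ℝ E)
    (hj : j + k = Module.finrank ℝ E) :
    (Set.finrank ℝ (A : Set (Module.Dual ℝ (E × ℝ)))).choose j ≤ #{G ∈ K | z G + v ∈ Q} := by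
  obtain ⟨q, hq⟩ := h.exists_pos
  have hbot : IsConeFace W ∅ := by
    refine ⟨Module.Dual.eval ℝ (E × ℝ) (q, 1), fun f hf => (hq f hf).le, fun f => ?_⟩
    simp only [Finset.notMem_empty, false_iff, not_and]
    exact fun hf => (hq f hf).ne'
  have h0 : Set.finrank ℝ ((∅ : Finset (Module.Dual ℝ (E × ℝ))) :
      Set (Module.Dual ℝ (E × ℝ))) = 0 := by
    rw [Finset.coe_empty, Set.finrank_empty]
  refine (hbot.choose_le_card hA (Finset.empty_subset _) (p := Set.finrank ℝ
    (A : Set (Module.Dual ℝ (E × ℝ)))) (by rw [h0, zero_add]) j).trans ?_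
  rw [h0, zero_add]
  refine Finset.card_le_card_of_injOn (face Q) (fun Y hY => ?_) fun Y hY Y' hY' heq => ?_
  · simp only [Finset.coe_filter, Set.mem_ofPred_eq] at hY ⊢
    obtain ⟨-, hYf, -, hYA, hYr⟩ := hY
    have hYv : ∀ f ∈ Y, 0 < f (v, 0) := fun f hf =>
      lt_of_le_of_ne (hA0 f (hYA hf)) (hv f (hYf.subset hf)).symm
    have hYK : face Q Y ∈ K := (hK _).2 (h.isKFace_face hYf hYv hk (by omega))
    refine ⟨hYK, (h.mem_iff _).2 fun f hf => ?_⟩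
    obtain ⟨x, hx, hpos⟩ := h.exists_point hYf (by omega)
    have hzY := hz _ hYK
    have hzmem := intrinsicInterior_subset hzY
    by_cases hfY : f ∈ Y
    · have h1 := map_mk_add_smul f (z (face Q Y)) v 1
      rw [one_smul, hzmem.2 f hfY] at h1
      rw [h1]
      have := hYv f hfY
      linarith
    · refine hsmall _ hYK f hf (lt_of_le_of_ne ((h.mem_iff _).1 hzmem.1 f hf) fun h2 => ?_)
      obtain ⟨ε, hε, hmem⟩ := exists_prolong_mem hzY hx
      have h3 := (h.mem_iff _).1 hmem.1 f hf
      have h4 : f (z (face Q Y) - x, 0) = f (z (face Q Y), 1) - f (x, 1) := by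
        rw [← map_sub]
        simp
      rw [map_mk_add_smul, h4, ← h2] at h3
      nlinarith [hpos f hf hfY]
  · simp only [Finset.coe_filter, Set.mem_ofPred_eq] at hY hY'
    have aux : ∀ {Y Y'}, IsConeFace W Y → IsConeFace W Y' →
        Set.finrank ℝ (Y' : Set (Module.Dual ℝ (E × ℝ))) = j → face Q Y = face Q Y' →
        Y ⊆ Y' := by
      intro Y Y' hY hY' hr heq f hf
      by_contra hfY'
      obtain ⟨x, hx, hpos⟩ := h.exists_point hY' (by omega)
      exact (hpos f (hY.subset hf) hfY').ne' ((heq ▸ hx : x ∈ face Q Y).2 f hf)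
    exact (aux hY.2.1 hY'.2.1 hY'.2.2.2.2 heq).antisymm
      (aux hY'.2.1 hY.2.1 hY.2.2.2.2 heq.symm)

open scoped Classical Finset in
lemma choose_add_choose_le_card_faces (h : IsHalfspaceRep Q W) {k j : ℕ} {K : Finset (Set E)}
    (hK : ∀ G, G ∈ K ↔ IsKFace Q k G) {z : Set E → E}
    (hz : ∀ G ∈ K, z G ∈ intrinsicInterior ℝ G) {v : E} (hv : ∀ f ∈ W, f (v, 0) ≠ 0)
    (hsmall : ∀ G ∈ K, ∀ f ∈ W, 0 < f (z G, 1) → 0 ≤ f (z G + v, 1) ∧ 0 ≤ f (z G - v, 1))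
    (hk : k < Module.finrank ℝ E) (hj : j + k = Module.finrank ℝ E) :
    ((Module.finrank ℝ E + 1 + 1) / 2).choose j + ((Module.finrank ℝ E + 1) / 2).choose j ≤
      #{G ∈ K | z G + v ∈ Q} + #{G ∈ K | z G - v ∈ Q} := by
  obtain ⟨q, hq⟩ := h.exists_pos
  have hbot : IsConeFace W ∅ := by
    refine ⟨Module.Dual.eval ℝ (E × ℝ) (q, 1), fun f hf => (hq f hf).le, fun f => ?_⟩
    simp only [Finset.notMem_empty, false_iff, not_and]
    exact fun hf => (hq f hf).ne'
  obtain ⟨A, B, hA, hB, -, -, hA0, hB0, hr⟩ :=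
    hbot.exists_opposite_faces (Module.Dual.eval ℝ (E × ℝ) (v, 0)) (by simp)
  rw [Finset.coe_empty, Set.finrank_empty, add_zero, h.finrank_eq] at hr
  have hneg : ∀ f : Module.Dual ℝ (E × ℝ), f (-v, 0) = -f (v, 0) := fun f => by
    rw [← map_neg]
    simp
  refine (choose_half_le hr j).trans (add_le_add ?_ ?_)
  · exact h.choose_le_card_faces hK hz hv (fun G hG f hf hf0 => (hsmall G hG f hf hf0).1)
      hA hA0 hk hj
  · have := h.choose_le_card_faces hK hz (v := -v)
      (fun f hf => by rw [hneg]; exact neg_ne_zero.2 (hv f hf))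
      (fun G hG f hf hf0 => by rw [← sub_eq_add_neg]; exact (hsmall G hG f hf hf0).2)
      hB (fun f hf => by
        rw [hneg]
        exact neg_nonneg.2 (le_of_lt (hB0 f hf (Finset.notMem_empty f)))) hk hj
    simpa only [sub_eq_add_neg] using this

end Counting

end IsHalfspaceRep

open MeasureTheory in
/-- The bound `φ_k(Q) ≥ ρ(n + 1, n - k)` for an `n`-polytope `Q`. -/
theorem IsPolytope.rho_le_solidAngleSum {n k : ℕ} {Q : Set (Euc n)} (hQ : IsPolytope Q)
    (hint : (interior Q).Nonempty) (hk : k < n) {s : ℝ} (hs : IsSolidAngleSum Q k s) :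
    ((rho (n + 1) (n - k) : ℚ) : ℝ) ≤ s := by
  classical
  have : Nonempty (Fin n) := ⟨⟨k, hk⟩⟩
  obtain ⟨K, a, hK, ha, rfl⟩ := hs
  replace hK : ∀ G, G ∈ K ↔ IsKFace Q k G := fun G => by
    rw [← Finset.mem_coe, hK]
    rfl
  obtain ⟨W, hW⟩ := hQ.exists_isHalfspaceRep hint
  have hfr : Module.finrank ℝ (Euc n) = n := finrank_euclideanSpace_fin
  have hcompact : IsCompact Q := by
    obtain ⟨V, rfl⟩ := hQ
    exact V.finite_toSet.isCompact_convexHull (𝕜 := ℝ)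
  have hconv : Convex ℝ Q := by
    obtain ⟨V, rfl⟩ := hQ
    exact convex_convexHull ℝ _
  have hz : ∀ G ∈ K, (intrinsicInterior ℝ G).Nonempty := by
    intro G hG
    obtain ⟨hface, hne, -⟩ := (hK G).1 hG
    refine hne.intrinsicInterior ?_
    rcases hface with rfl | rfl | ⟨f, -, c, -, rfl⟩
    · exact hconv
    · exact convex_empty
    · exact hconv.inter (convex_hyperplane f.isLinear c)
  choose! z hz using hz
  have hev : ∀ᶠ r in nhdsWithin (0 : ℝ) (Set.Ioi 0), ∀ G ∈ K,
      (volume (Metric.ball (z G) r ∩ Q)).toReal / (volume (Metric.ball (z G) r)).toReal = a G ∧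
      ∀ f ∈ W, 0 < f (z G, 1) → ∀ v ∈ Metric.ball (0 : Euc n) r, 0 ≤ f (z G + v, 1) := by
    rw [Filter.eventually_all_finset]
    intro G hG
    refine (ha G hG _ (hz G hG)).and ?_
    rw [Filter.eventually_all_finset]
    intro f hf
    by_cases hpos : 0 < f (z G, 1)
    · have hc : Continuous fun v : Euc n => f (z G + v, 1) :=
        f.continuous_of_finiteDimensional.comp (by fun_prop)
      have h1 : ∀ᶠ v in nhds (0 : Euc n), 0 < f (z G + v, 1) :=
        hc.continuousAt.eventually_const_lt (by simpa using hpos)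
      obtain ⟨δ, hδ, hball⟩ := Metric.eventually_nhds_iff_ball.1 h1
      filter_upwards [Ioo_mem_nhdsGT hδ] with r hr _ v hv
      exact (hball v (Metric.ball_subset_ball hr.2.le hv)).le
    · exact Filter.Eventually.of_forall fun r h => absurd h hpos
  obtain ⟨r, hr, (hr0 : 0 < r)⟩ := (hev.and self_mem_nhdsWithin).exists
  have hgen : ∀ᵐ v : Euc n, ∀ f ∈ W, f (v, 0) ≠ 0 := by
    rw [Filter.eventually_all_finset]
    intro f hf
    have hne : LinearMap.ker (f ∘ₗ LinearMap.inl ℝ (Euc n) ℝ) ≠ ⊤ := by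
      intro htop
      obtain ⟨y, hy⟩ := hW.exists_ne f hf
      have : y ∈ LinearMap.ker (f ∘ₗ LinearMap.inl ℝ (Euc n) ℝ) := htop ▸ Submodule.mem_top
      exact hy this
    have h0 := Measure.addHaar_submodule (volume : Measure (Euc n)) _ hne
    rw [ae_iff]
    convert h0 using 2
    ext v
    simp
  set N : ℕ := ((n + 1 + 1) / 2).choose (n - k) + ((n + 1) / 2).choose (n - k) with hN
  set S : Set (Euc n) → Set (Euc n) := fun G => Metric.ball (z G) r ∩ Q with hS
  have hSm : ∀ G, MeasurableSet (S G) := fun G =>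
    Metric.isOpen_ball.measurableSet.inter hcompact.isClosed.measurableSet
  have hcount : ∀ᵐ v : Euc n, (Metric.ball (0 : Euc n) r).indicator (fun _ => (N : ENNReal)) v ≤
      ∑ G ∈ K, (((fun v => z G + v) ⁻¹' S G).indicator 1 v +
        ((fun v => z G - v) ⁻¹' S G).indicator 1 v) := by
    filter_upwards [hgen] with v hv
    by_cases hvr : v ∈ Metric.ball (0 : Euc n) r
    · have hvr' : -v ∈ Metric.ball (0 : Euc n) r := by simpa using hvr
      have h1 := hW.choose_add_choose_le_card_faces (j := n - k) hK hz hv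
        (fun G hG f hf hpos => ⟨(hr G hG).2 f hf hpos v hvr, by
          simpa only [sub_eq_add_neg] using (hr G hG).2 f hf hpos (-v) hvr'⟩)
        (by rw [hfr]; exact hk) (by rw [hfr]; omega)
      rw [hfr, ← hN] at h1
      rw [Set.indicator_of_mem hvr, Finset.sum_add_distrib]
      refine le_trans (Nat.cast_le.2 h1) (le_of_eq ?_)
      have hvn : ‖v‖ < r := by simpa using hvr
      rw [Nat.cast_add, ← Finset.sum_boole, ← Finset.sum_boole]
      congr 1
      · refine Finset.sum_congr rfl fun G _ => ?_
        simp [Set.indicator_apply, hS, hvn]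
      · refine Finset.sum_congr rfl fun G _ => ?_
        simp [Set.indicator_apply, hS, hvn]
    · rw [Set.indicator_of_notMem hvr]
      exact zero_le
  have hmp : ∀ G, MeasurePreserving (fun v => z G + v) (volume : Measure (Euc n)) volume :=
    fun G => measurePreserving_add_left volume (z G)
  have hmm : ∀ G, MeasurePreserving (fun v => z G - v) (volume : Measure (Euc n)) volume :=
    fun G => Measure.measurePreserving_sub_left volume (z G)
  have hint' := lintegral_mono_ae hcount
  rw [lintegral_indicator_const Metric.isOpen_ball.measurableSet, lintegral_finsetSum] at hint'
  swap
  · intro G _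
    exact (measurable_one.indicator ((hmp G).measurable (hSm G))).add
      (measurable_one.indicator ((hmm G).measurable (hSm G)))
  have hterm : ∀ G ∈ K, (∫⁻ v : Euc n, (((fun v => z G + v) ⁻¹' S G).indicator 1 v +
        ((fun v => z G - v) ⁻¹' S G).indicator 1 v)) = 2 * volume (S G) := by
    intro G _
    rw [lintegral_add_left (measurable_one.indicator ((hmp G).measurable (hSm G))),
      lintegral_indicator_one ((hmp G).measurable (hSm G)),
      lintegral_indicator_one ((hmm G).measurable (hSm G)),
      (hmp G).measure_preimage (hSm G).nullMeasurableSet,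
      (hmm G).measure_preimage (hSm G).nullMeasurableSet, two_mul]
  rw [Finset.sum_congr rfl hterm, ← Finset.mul_sum] at hint'
  have hSfin : ∀ G ∈ K, volume (S G) ≠ ⊤ := fun G _ =>
    ((measure_mono Set.inter_subset_left).trans_lt measure_ball_lt_top).ne
  have hreal := ENNReal.toReal_mono
    (ENNReal.mul_ne_top (by simp) (ENNReal.sum_ne_top.2 hSfin)) hint'
  rw [ENNReal.toReal_mul, ENNReal.toReal_mul, ENNReal.toReal_sum hSfin, ENNReal.toReal_natCast,
    ENNReal.toReal_ofNat] at hreal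
  have hBpos : 0 < (volume (Metric.ball (0 : Euc n) r)).toReal :=
    ENNReal.toReal_pos (Metric.measure_ball_pos volume 0 hr0).ne' measure_ball_lt_top.ne
  have hSa : ∀ G ∈ K, (volume (S G)).toReal =
      a G * (volume (Metric.ball (0 : Euc n) r)).toReal := by
    intro G hG
    have hB : volume (Metric.ball (z G) r) = volume (Metric.ball (0 : Euc n) r) :=
      Measure.addHaar_ball_center volume (z G) r
    have := (hr G hG).1
    rw [hB, div_eq_iff hBpos.ne'] at this
    exact this
  rw [Finset.sum_congr rfl hSa, ← Finset.sum_mul, ← mul_assoc] at hreal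
  have hfinal := le_of_mul_le_mul_right hreal hBpos
  have hrho : ((rho (n + 1) (n - k) : ℚ) : ℝ) = (N : ℝ) / 2 := by
    rw [rho, hN]
    push_cast
    rfl
  rw [hrho]
  linarith

/-- A supporting hyperplane cuts a polytope in a polytope. -/
lemma IsPolytope.of_supporting {E : Type*} [NormedAddCommGroup E] [InnerProductSpace ℝ E]
    {P : Set E} (hP : IsPolytope P) (f : E →L[ℝ] ℝ) {c : ℝ} (hf : ∀ x ∈ P, f x ≤ c) :
    IsPolytope {x ∈ P | f x = c} := by
  classical
  obtain ⟨V, rfl⟩ := hP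
  refine ⟨{v ∈ V | f v = c}, Set.Subset.antisymm ?_ fun x hx => ?_⟩
  · rintro x ⟨hx, hxc⟩
    obtain ⟨w, hw0, hw1, rfl⟩ := Finset.mem_convexHull'.1 hx
    have hsum : ∑ v ∈ V, w v * (c - f v) = 0 := by
      simp only [mul_sub, Finset.sum_sub_distrib, ← Finset.sum_mul, hw1, one_mul]
      rw [← hxc, map_sum]
      simp
    have hz := (Finset.sum_eq_zero_iff_of_nonneg fun v hv => mul_nonneg (hw0 v hv)
      (sub_nonneg.2 (hf v (subset_convexHull ℝ _ hv)))).1 hsum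
    have hw : ∀ v ∈ V, w v ≠ 0 → f v = c := fun v hv hne => by
      have := (mul_eq_zero.1 (hz v hv)).resolve_left hne
      linarith
    refine Finset.mem_convexHull'.2 ⟨w, fun v hv => hw0 v (Finset.mem_filter.1 hv).1, ?_, ?_⟩
    · rw [Finset.sum_filter_of_ne hw, hw1]
    · exact Finset.sum_filter_of_ne fun v hv hne => hw v hv fun h0 => hne (by rw [h0, zero_smul])
  · refine ⟨convexHull_mono (Finset.coe_subset.2 (Finset.filter_subset _ V)) hx, ?_⟩
    have hsub : convexHull ℝ (({v ∈ V | f v = c} : Finset E) : Set E) ⊆ {x | f x = c} :=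
      convexHull_min (fun v hv => (Finset.mem_filter.1 hv).2)
        (convex_hyperplane f.isLinear c)
    exact hsub hx

/-- A polytope pulled back along an affine isometry onto its affine hull is a polytope with
nonempty interior. -/
lemma IsPolytope.preimage_isometry {n m : ℕ} {F : Set (Euc m)} (hF : IsPolytope F)
    (hne : F.Nonempty) (e : Euc n →ᵃⁱ[ℝ] Euc m)
    (he : Set.range ⇑e = (affineSpan ℝ F : Set (Euc m))) :
    IsPolytope (⇑e ⁻¹' F) ∧ (interior (⇑e ⁻¹' F)).Nonempty := by
  classical
  have himg : ⇑e '' (⇑e ⁻¹' F) = F :=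
    Set.image_preimage_eq_of_subset (he ▸ subset_affineSpan ℝ F)
  have hpoly : IsPolytope (⇑e ⁻¹' F) := by
    obtain ⟨V, rfl⟩ := hF
    refine ⟨V.preimage e e.injective.injOn, ?_⟩
    have hV : ⇑e '' (V.preimage e e.injective.injOn : Set (Euc n)) = V := by
      rw [Finset.coe_preimage]
      refine Set.image_preimage_eq_of_subset ?_
      rw [he]
      exact (subset_convexHull ℝ _).trans (subset_affineSpan ℝ _)
    have h1 := e.toAffineMap.image_convexHull (V.preimage e e.injective.injOn : Set (Euc n))
    simp only [AffineIsometry.coe_toAffineMap, hV] at h1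
    rw [← h1, Set.preimage_image_eq _ e.injective]
  refine ⟨hpoly, ?_⟩
  have hconv : Convex ℝ (⇑e ⁻¹' F) := by
    obtain ⟨V, hV⟩ := hpoly
    rw [hV]
    exact convex_convexHull ℝ _
  rw [hconv.interior_nonempty_iff_affineSpan_eq_top, eq_top_iff]
  intro y _
  have hmap := AffineSubspace.map_span e.toAffineMap (⇑e ⁻¹' F)
  simp only [AffineIsometry.coe_toAffineMap, himg] at hmap
  have hy : e y ∈ (affineSpan ℝ F : Set (Euc m)) := he ▸ Set.mem_range_self y
  rw [← hmap] at hy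
  obtain ⟨y', hy', heq⟩ := hy
  exact e.injective heq ▸ hy'

/-- Let `d ≥ 2`, let `P` be a `d`-polytope, and `0 ≤ k ≤ d-2`. Then
`Σ_{F facet of P} φ_k(F) ≥ ρ(d, d-k-1) ⬝ f_{d-1}(P)`, where each `φ_k(F)` is computed
with `F` regarded as a `(d-1)`-polytope in its own affine hull. -/
theorem facet_solid_angle_sum_lower_bound (d : ℕ) (hd : 2 ≤ d) (P : Set (Euc d))
    (hP : IsPolytope P) (hPdim : dimSet P = d) (k : ℕ) (hk : k + 2 ≤ d)
    (facets : Finset (Set (Euc d)))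
    (hfacets : (facets : Set (Set (Euc d))) = {F | IsKFace P (d - 1) F})
    (φ : Set (Euc d) → ℝ) (hφ : ∀ F ∈ facets, IsIntrinsicSolidAngleSum F k (φ F)) :
    ((rho d (d - k - 1) : ℚ) : ℝ) * (fVec P (d - 1) : ℝ) ≤ ∑ F ∈ facets, φ F := by
  obtain ⟨n, rfl⟩ : ∃ n, d = n + 1 := ⟨d - 1, by omega⟩
  have hcard : fVec P (n + 1 - 1) = facets.card := by
    rw [fVec, ← hfacets, Set.ncard_coe_finset]
  have hbound : ∀ F ∈ facets, ((rho (n + 1) (n + 1 - k - 1) : ℚ) : ℝ) ≤ φ F := by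
    intro F hF
    obtain ⟨e, he, hs⟩ := hφ F hF
    rw [← Finset.mem_coe, hfacets] at hF
    obtain ⟨hface, hne, hdim⟩ := hF
    have hFP : IsPolytope F := by
      rcases hface with rfl | rfl | ⟨f, -, c, hf, rfl⟩
      · exact hP
      · exact absurd hne Set.not_nonempty_empty
      · exact hP.of_supporting f hf
    obtain ⟨h1, h2⟩ := hFP.preimage_isometry hne e he
    have h3 := h1.rho_le_solidAngleSum h2 (by omega) hs
    rwa [show n + 1 - k - 1 = n + 1 - 1 - k by omega]
  rw [hcard, mul_comm, ← nsmul_eq_mul]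
  exact Finset.card_nsmul_le_sum facets φ _ hbound
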